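/- arXiv:2210.13983 — 4 statements merged into one kernel-verified Lean document; each statement's English description precedes it below -/
import Mathlib

section
/- (One-step contraction of the optimality gap.) Let F : E → ℝ be differentiable and L-smooth with L > 0, let x̂ ∈ E be a global minimizer of F, and let μ > 0. Suppose x ∈ E satisfies the Polyak–Łojasiewicz inequality F(x) − F(x̂) ≤ (1/(2μ))·‖∇F(x)‖². Then the gradient step x⁺ = x − (1/L)·∇F(x) satisfies F(x⁺) − F(x̂) ≤ (1 − μ/L)·(F(x) − F(x̂)). -/
/-- One-step contraction of the optimality gap under a pointwise
Polyak–Łojasiewicz inequality. -/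
theorem one_step_contraction
    (n : ℕ) (F : EuclideanSpace ℝ (Fin n) → ℝ)
    (hF : Differentiable ℝ F)
    (L : ℝ) (hL : 0 < L)
    (hsmooth : ∀ x₁ x₂, ‖gradient F x₁ - gradient F x₂‖ ≤ L * ‖x₁ - x₂‖)
    (xhat : EuclideanSpace ℝ (Fin n))
    (hmin : ∀ x, F xhat ≤ F x)
    (μ : ℝ) (hμ : 0 < μ)
    (x : EuclideanSpace ℝ (Fin n))
    (hPL : F x - F xhat ≤ 1 / (2 * μ) * ‖gradient F x‖ ^ 2) :
    F (x - (1 / L) • gradient F x) - F xhat ≤ (1 - μ / L) * (F x - F xhat) := by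
  set g := gradient F x with hg
  have hd : ∀ t : ℝ, HasDerivAt (fun t : ℝ => F (x - t • g))
      (-(inner ℝ (gradient F (x - t • g)) g)) t := by
    intro t
    have h1 : HasDerivAt (fun t : ℝ => x - t • g) (-g) t := by
      simpa using ((hasDerivAt_id t).smul_const g).const_sub x
    have h2 := (hF (x - t • g)).hasGradientAt.hasFDerivAt
    have h3 := h2.comp_hasDerivAt t h1
    simpa [Function.comp_def, InnerProductSpace.toDual_apply_apply] using h3
  have hB : ∀ t : ℝ, HasDerivAt (fun t : ℝ => F x + (L / 2 * t ^ 2 - t) * ‖g‖ ^ 2)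
      ((L * t - 1) * ‖g‖ ^ 2) t := by
    intro t
    have h := (((((hasDerivAt_id t).pow 2).const_mul (L / 2)).sub
      (hasDerivAt_id t)).mul_const (‖g‖ ^ 2)).const_add (F x)
    refine h.congr_deriv ?_
    simp only [id, Nat.cast_ofNat]
    ring
  have hbound : ∀ t ∈ Set.Ico (0 : ℝ) (1 / L),
      -(inner ℝ (gradient F (x - t • g)) g) ≤ (L * t - 1) * ‖g‖ ^ 2 := by
    intro t ht
    have h1 := hsmooth x (x - t • g)
    rw [← hg, sub_sub_cancel, norm_smul, Real.norm_of_nonneg ht.1] at h1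
    have h2 := real_inner_le_norm (g - gradient F (x - t • g)) g
    rw [inner_sub_left, real_inner_self_eq_norm_sq] at h2
    have h3 := mul_le_mul_of_nonneg_right h1 (norm_nonneg g)
    nlinarith
  have key := image_le_of_deriv_right_le_deriv_boundary
    (fun t _ => (hd t).continuousAt.continuousWithinAt)
    (fun t _ => (hd t).hasDerivWithinAt) (by simp)
    (fun t _ => (hB t).continuousAt.continuousWithinAt)
    (fun t _ => (hB t).hasDerivWithinAt) hbound
    (Set.right_mem_Icc.mpr (by positivity : (0 : ℝ) ≤ 1 / L))
  have e1 : (L / 2 * (1 / L) ^ 2 - 1 / L) * ‖g‖ ^ 2 = -(‖g‖ ^ 2 / (2 * L)) := by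
    field_simp
    ring
  have e2 : μ / L * (F x - F xhat) ≤ ‖g‖ ^ 2 / (2 * L) := by
    have h := mul_le_mul_of_nonneg_left hPL (by positivity : 0 ≤ μ / L)
    refine h.trans_eq ?_
    field_simp
  rw [e1] at key
  linarith
end

section
/- (Linear convergence of function values while iterates remain in the ball; equation (A.recursion).) Let F : E → ℝ be differentiable and L-smooth with L > 0, let x̂ ∈ E be a global minimizer of F, and let μ > 0, δ > 0 be such that the local Polyak–Łojasiewicz condition holds: F(x) − F(x̂) ≤ (1/(2μ))·‖∇F(x)‖² for all x ∈ B(x̂, δ). Let x₀ ∈ E and let x_{j+1} = x_j − (1/L)·∇F(x_j) be the gradient-descent iterates. If x_j ∈ B(x̂, δ) for all 0 ≤ j ≤ k − 1, then F(x_k) − F(x̂) ≤ (1 − μ/L)^k · (F(x₀) − F(x̂)). -/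
open Metric

theorem descent_aux
    (n : ℕ) (F : EuclideanSpace ℝ (Fin n) → ℝ)
    (hF : Differentiable ℝ F)
    (L : ℝ) (hL : 0 < L)
    (hsmooth : ∀ x₁ x₂, ‖gradient F x₁ - gradient F x₂‖ ≤ L * ‖x₁ - x₂‖)
    (x : EuclideanSpace ℝ (Fin n)) :
    F (x - (1 / L) • gradient F x) ≤ F x - 1 / (2 * L) * ‖gradient F x‖ ^ 2 := by
  set g := gradient F x with hg
  have hd : ∀ t : ℝ, HasDerivAt (fun t : ℝ => F (x - t • g))
      (-(inner ℝ (gradient F (x - t • g)) g)) t := by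
    intro t
    have h1 := (hF (x - t • g)).hasGradientAt.hasFDerivAt
    have h2 : HasDerivAt (fun t : ℝ => x - t • g) (-((1 : ℝ) • g)) t :=
      ((hasDerivAt_id t).smul_const g).const_sub x
    have h3 := h1.comp_hasDerivAt t h2
    simpa [Function.comp_def] using h3
  have hB : ∀ t : ℝ, HasDerivAt (fun t : ℝ => F x + (-t + L / 2 * t ^ 2) * ‖g‖ ^ 2)
      ((-1 + L * t) * ‖g‖ ^ 2) t := by
    intro t
    have h := ((((hasDerivAt_id t).neg).add
      (((hasDerivAt_id t).pow 2).const_mul (L / 2))).mul_const (‖g‖ ^ 2)).const_add (F x)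
    refine h.congr_deriv ?_
    norm_num only [id, Nat.cast_ofNat, pow_one]
    ring
  have key := image_le_of_deriv_right_le_deriv_boundary (a := 0) (b := 1 / L)
    (fun t _ => (hd t).continuousAt.continuousWithinAt)
    (fun t _ => (hd t).hasDerivWithinAt) (by simp)
    (fun t _ => (hB t).continuousAt.continuousWithinAt)
    (fun t _ => (hB t).hasDerivWithinAt) (by
      intro t ht
      have h1 := hsmooth x (x - t • g)
      have h2 : ‖x - (x - t • g)‖ = t * ‖g‖ := by
        rw [sub_sub_cancel, norm_smul, Real.norm_of_nonneg ht.1]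
      rw [h2, ← hg] at h1
      have h3 := real_inner_le_norm (g - gradient F (x - t • g)) g
      rw [inner_sub_left, real_inner_self_eq_norm_sq] at h3
      have h4 := mul_le_mul_of_nonneg_right h1 (norm_nonneg g)
      nlinarith)
  have := key (Set.right_mem_Icc.2 (by positivity))
  refine this.trans (le_of_eq ?_)
  field_simp
  ring

/-- Equation (A.recursion): linear convergence of the function values of
gradient descent while the iterates remain in the ball where the local
Polyak–Łojasiewicz condition holds. -/
theorem linear_convergence_values
    (n : ℕ) (F : EuclideanSpace ℝ (Fin n) → ℝ)
    (hF : Differentiable ℝ F)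
    (L : ℝ) (hL : 0 < L)
    (hsmooth : ∀ x₁ x₂, ‖gradient F x₁ - gradient F x₂‖ ≤ L * ‖x₁ - x₂‖)
    (xhat : EuclideanSpace ℝ (Fin n))
    (hmin : ∀ x, F xhat ≤ F x)
    (μ δ : ℝ) (hμ : 0 < μ) (hδ : 0 < δ)
    (hPL : ∀ x ∈ closedBall xhat δ,
      F x - F xhat ≤ 1 / (2 * μ) * ‖gradient F x‖ ^ 2)
    (x : ℕ → EuclideanSpace ℝ (Fin n))
    (hiter : ∀ j : ℕ, x (j + 1) = x j - (1 / L) • gradient F (x j))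
    (k : ℕ)
    (hball : ∀ j : ℕ, j < k → x j ∈ closedBall xhat δ) :
    F (x k) - F xhat ≤ (1 - μ / L) ^ k * (F (x 0) - F xhat) := by
  have hstep : ∀ j, j < k →
      F (x (j + 1)) - F xhat ≤ (1 - μ / L) * (F (x j) - F xhat) := by
    intro j hj
    have h1 := descent_aux n F hF L hL hsmooth (x j)
    rw [← hiter j] at h1
    have h2 := mul_le_mul_of_nonneg_left (hPL _ (hball j hj)) (by positivity : 0 ≤ μ / L)
    have h3 : μ / L * (1 / (2 * μ) * ‖gradient F (x j)‖ ^ 2)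
        = 1 / (2 * L) * ‖gradient F (x j)‖ ^ 2 := by
      field_simp
    linarith
  rcases le_or_gt 0 (1 - μ / L) with hc | hc
  · have : ∀ m, m ≤ k → F (x m) - F xhat ≤ (1 - μ / L) ^ m * (F (x 0) - F xhat) := by
      intro m
      induction m with
      | zero => simp
      | succ m ih =>
        intro hm
        have h1 := mul_le_mul_of_nonneg_left (ih (by omega)) hc
        rw [pow_succ']
        linarith [hstep m (by omega)]
    exact this k le_rfl
  · have hz : ∀ j, j < k → F (x j) - F xhat = 0 := by
      intro j hj
      have h1 := hstep j hj
      have h2 := hmin (x (j + 1))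
      have h3 := hmin (x j)
      nlinarith
    cases k with
    | zero => simp
    | succ m =>
      have h1 := hstep m (by omega)
      rw [hz m (by omega)] at h1
      rw [hz 0 (by omega)]
      simpa using h1
end

section
/- (Warm-start step of the cascade: the inductive step in the proof of Theorem 1.) Let Λ > 0 and let 𝓛 : [0, Λ] × E → ℝ, (λ, x) ↦ 𝓛(x; λ), be differentiable in x. Assume: (A1) there is L > 0 such that for every λ ∈ [0, Λ] the function x ↦ 𝓛(x; λ) is L-smooth; (A2) there exist σ > 0, δ > 0 and a map x̂ : [0, Λ] → E such that for every λ ∈ [0, Λ], x̂(λ) is a global minimizer of 𝓛(·; λ) and ‖x − x̂(λ)‖ ≤ σ·‖∇ₓ𝓛(x; λ)‖ for every x ∈ B(x̂(λ), δ); (A3) there is C > 0 with ‖x̂(λ₁) − x̂(λ₂)‖ ≤ C·|λ₁ − λ₂| for all λ₁, λ₂ ∈ [0, Λ]. Set μ = 1/(2Lσ²), assume L·σ ≥ 1, and let δ₀ = min{δ, (μ/√(2(L − μ)L))·δ}. Let λ, λ′ ∈ [0, Λ] with |λ′ − λ| ≤ δ₀/(2C), let x₀ ∈ B(x̂(λ),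 δ₀), and let K ∈ ℕ satisfy (1 − μ/L)^{K/2}·δ ≤ δ₀/2. Then the K-th gradient-descent iterate x_K of 𝓛(·; λ) with step size 1/L started at x₀ satisfies ‖x_K − x̂(λ′)‖ ≤ δ₀. -/
open Metric

theorem descent_aux_s10 {E : Type*} [NormedAddCommGroup E] [InnerProductSpace ℝ E] [CompleteSpace E]
    (f : E → ℝ) (hf : Differentiable ℝ f) (L : ℝ)
    (hs : ∀ x₁ x₂, ‖gradient f x₁ - gradient f x₂‖ ≤ L * ‖x₁ - x₂‖) (x d : E) :
    f (x + d) ≤ f x + inner ℝ (gradient f x) d + L / 2 * ‖d‖ ^ 2 := by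
  have hder : ∀ t : ℝ, HasDerivAt
      (fun t : ℝ => f (x + t • d) - t * inner ℝ (gradient f x) d - L / 2 * ‖d‖ ^ 2 * t ^ 2)
      (inner ℝ (gradient f (x + t • d)) d - inner ℝ (gradient f x) d - L * ‖d‖ ^ 2 * t) t := by
    intro t
    have h1 : HasDerivAt (fun t : ℝ => x + t • d) d t := by
      simpa using ((hasDerivAt_id t).smul_const d).const_add x
    have h2 := ((hf (x + t • d)).hasGradientAt.hasFDerivAt).comp_hasDerivAt t h1
    have h2' : HasDerivAt (fun t : ℝ => f (x + t • d))
        (inner ℝ (gradient f (x + t • d)) d) t := by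
      have h2a : (InnerProductSpace.toDual ℝ E (gradient f (x + t • d))) d =
          inner ℝ (gradient f (x + t • d)) d := InnerProductSpace.toDual_apply_apply
      rw [← h2a]
      exact h2
    have h3 : HasDerivAt (fun t : ℝ => t * inner ℝ (gradient f x) d)
        (inner ℝ (gradient f x) d) t := by
      simpa using (hasDerivAt_id t).mul_const (inner ℝ (gradient f x) d)
    have h4 : HasDerivAt (fun t : ℝ => L / 2 * ‖d‖ ^ 2 * t ^ 2) (L * ‖d‖ ^ 2 * t) t := by
      have := (hasDerivAt_pow 2 t).const_mul (L / 2 * ‖d‖ ^ 2)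
      refine this.congr_deriv ?_
      norm_num
      ring
    exact (h2'.sub h3).sub h4
  have hanti := antitoneOn_of_deriv_nonpos (convex_Icc (0:ℝ) 1)
    (fun t _ => (hder t).continuousAt.continuousWithinAt)
    (fun t _ => (hder t).differentiableAt.differentiableWithinAt)
    (fun t ht => by
      rw [(hder t).deriv]
      rw [interior_Icc] at ht
      have h5 := hs (x + t • d) x
      have h6 := real_inner_le_norm (gradient f (x + t • d) - gradient f x) d
      rw [inner_sub_left] at h6
      rw [add_sub_cancel_left, norm_smul, Real.norm_of_nonneg ht.1.le] at h5
      have h7 := mul_le_mul_of_nonneg_right h5 (norm_nonneg d)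
      nlinarith)
  have := hanti (Set.left_mem_Icc.2 zero_le_one) (Set.right_mem_Icc.2 zero_le_one) zero_le_one
  simp only [one_smul, zero_smul, add_zero, one_mul, zero_mul] at this
  linarith

/-- Warm-start step of the cascade (inductive step in the proof of Theorem 1):
starting `δ₀`-close to `x̂(λ)`, after `K` gradient steps on `𝓛(·; λ)` with
`(1 − μ/L)^{K/2}·δ ≤ δ₀/2`, the result is `δ₀`-close to `x̂(λ′)` whenever
`|λ′ − λ| ≤ δ₀/(2C)`. -/
theorem cascade_warm_start
    (n : ℕ) (Λ : ℝ) (hΛ : 0 < Λ)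
    (𝓛 : ℝ → EuclideanSpace ℝ (Fin n) → ℝ)
    (hdiff : ∀ lam ∈ Set.Icc (0 : ℝ) Λ, Differentiable ℝ (𝓛 lam))
    (L : ℝ) (hL : 0 < L)
    (hsmooth : ∀ lam ∈ Set.Icc (0 : ℝ) Λ, ∀ x₁ x₂,
      ‖gradient (𝓛 lam) x₁ - gradient (𝓛 lam) x₂‖ ≤ L * ‖x₁ - x₂‖)
    (σ δ : ℝ) (hσ : 0 < σ) (hδ : 0 < δ)
    (xhat : ℝ → EuclideanSpace ℝ (Fin n))
    (hmin : ∀ lam ∈ Set.Icc (0 : ℝ) Λ, ∀ x, 𝓛 lam (xhat lam) ≤ 𝓛 lam x)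
    (herr : ∀ lam ∈ Set.Icc (0 : ℝ) Λ, ∀ x ∈ closedBall (xhat lam) δ,
      ‖x - xhat lam‖ ≤ σ * ‖gradient (𝓛 lam) x‖)
    (C : ℝ) (hC : 0 < C)
    (hlip : ∀ lam₁ ∈ Set.Icc (0 : ℝ) Λ, ∀ lam₂ ∈ Set.Icc (0 : ℝ) Λ,
      ‖xhat lam₁ - xhat lam₂‖ ≤ C * |lam₁ - lam₂|)
    (μ : ℝ) (hμ : μ = 1 / (2 * L * σ ^ 2))
    (hLσ : 1 ≤ L * σ)
    (δ₀ : ℝ) (hδ₀ : δ₀ = min δ (μ / Real.sqrt (2 * (L - μ) * L) * δ))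
    (lam lam' : ℝ) (hlam : lam ∈ Set.Icc (0 : ℝ) Λ)
    (hlam' : lam' ∈ Set.Icc (0 : ℝ) Λ)
    (hclose : |lam' - lam| ≤ δ₀ / (2 * C))
    (x₀ : EuclideanSpace ℝ (Fin n)) (hx₀ : x₀ ∈ closedBall (xhat lam) δ₀)
    (K : ℕ) (hK : (1 - μ / L) ^ ((K : ℝ) / 2) * δ ≤ δ₀ / 2) :
    ‖(fun x => x - (1 / L) • gradient (𝓛 lam) x)^[K] x₀ - xhat lam'‖ ≤ δ₀ := by
  have hd := descent_aux_s10 (𝓛 lam) (hdiff lam hlam) L (hsmooth lam hlam)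
  have hm := hmin lam hlam
  have he := herr lam hlam
  have hxx := hlip lam hlam lam' hlam'
  set f := 𝓛 lam with hf
  set xs := xhat lam with hxs
  have hstep : ∀ x, f (x - (1 / L) • gradient f x) ≤ f x - 1 / (2 * L) * ‖gradient f x‖ ^ 2 := by
    intro x
    have h := hd x (-((1 / L) • gradient f x))
    rw [← sub_eq_add_neg, inner_neg_right, inner_smul_right, real_inner_self_eq_norm_sq, norm_neg,
      norm_smul, Real.norm_of_nonneg (by positivity)] at h
    convert h using 1
    field_simp
    ring
  have hg : ∀ x, 1 / (2 * L) * ‖gradient f x‖ ^ 2 ≤ f x - f xs := fun x => by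
    linarith [hm (x - (1 / L) • gradient f x), hstep x]
  have hg0 : gradient f xs = 0 := by
    have h := hg xs
    rw [sub_self] at h
    have h2 : 0 < 1 / (2 * L) := by positivity
    have h3 : ‖gradient f xs‖ ^ 2 ≤ 0 := by
      by_contra h4
      push Not at h4
      nlinarith [mul_pos h2 h4]
    have h5 : ‖gradient f xs‖ = 0 := by nlinarith [norm_nonneg (gradient f xs)]
    exact norm_eq_zero.1 h5
  have hup : ∀ x, f x - f xs ≤ L / 2 * ‖x - xs‖ ^ 2 := by
    intro x
    have h := hd xs (x - xs)
    rw [hg0, inner_zero_left, add_sub_cancel] at h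
    linarith
  have hgl : ∀ x, ‖gradient f x‖ ≤ L * ‖x - xs‖ := by
    intro x
    have h := hsmooth lam hlam x xs
    rwa [← hf, hg0, sub_zero] at h
  have hμ0 : 0 < μ := by rw [hμ]; positivity
  have hμσ : μ * (2 * L * σ ^ 2) = 1 := by rw [hμ]; field_simp
  have hμL : 2 * μ ≤ L := by
    have h1 : 1 ≤ (L * σ) ^ 2 := one_le_pow₀ hLσ
    have h2 : L = 2 * μ * (L * σ) ^ 2 := by
      calc L = L * (μ * (2 * L * σ ^ 2)) := by rw [hμσ, mul_one]
        _ = _ := by ring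
    nlinarith
  -- error bound squared
  have hes : ∀ x, ‖x - xs‖ ≤ δ → 2 * L * μ * ‖x - xs‖ ^ 2 ≤ ‖gradient f x‖ ^ 2 := by
    intro x hx
    have h := he x (by rwa [mem_closedBall, dist_eq_norm])
    have h2 : ‖x - xs‖ ^ 2 ≤ (σ * ‖gradient f x‖) ^ 2 := pow_le_pow_left₀ (norm_nonneg _) h 2
    have h3 : 2 * L * μ * ‖x - xs‖ ^ 2 ≤ 2 * L * μ * (σ * ‖gradient f x‖) ^ 2 :=
      mul_le_mul_of_nonneg_left h2 (by positivity)
    calc _ ≤ _ := h3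
      _ = (μ * (2 * L * σ ^ 2)) * ‖gradient f x‖ ^ 2 := by ring
      _ = _ := by rw [hμσ, one_mul]
  have hqg : ∀ x, ‖x - xs‖ ≤ δ → μ * ‖x - xs‖ ^ 2 ≤ f x - f xs := by
    intro x hx
    refine le_trans ?_ (hg x)
    have := mul_le_mul_of_nonneg_left (hes x hx) (show 0 ≤ 1 / (2 * L) by positivity)
    refine le_trans (le_of_eq ?_) this
    field_simp
  have hδ₀δ : δ₀ ≤ δ := hδ₀ ▸ min_le_left _ _
  have hS : 0 < 2 * (L - μ) * L := by
    have : 0 < L - μ := by linarith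
    positivity
  have hδ₀0 : 0 < δ₀ := by
    rw [hδ₀]
    have := Real.sqrt_pos.2 hS
    exact lt_min hδ (by positivity)
  have hδ₀2 : 2 * L * δ₀ ^ 2 ≤ μ * δ ^ 2 := by
    have h1 : δ₀ ≤ μ / Real.sqrt (2 * (L - μ) * L) * δ := hδ₀ ▸ min_le_right _ _
    have h2 := pow_le_pow_left₀ hδ₀0.le h1 2
    rw [mul_pow, div_pow, Real.sq_sqrt hS.le, div_mul_eq_mul_div, le_div_iff₀ hS] at h2
    have h3 : μ * L ≤ 2 * (L - μ) * L - 0 := by nlinarith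
    have h4 : δ₀ ^ 2 * (2 * μ * L) ≤ δ₀ ^ 2 * (2 * (L - μ) * L) :=
      mul_le_mul_of_nonneg_left (by nlinarith) (sq_nonneg _)
    have h5 : μ * (2 * L * δ₀ ^ 2) ≤ μ * (μ * δ ^ 2) := by linarith
    exact le_of_mul_le_mul_left h5 hμ0
  have hq0 : 0 < 1 - μ / L := by
    have : μ / L < 1 := by rw [div_lt_one hL]; linarith
    linarith
  have hq1 : 1 - μ / L ≤ 1 := by
    have : 0 < μ / L := by positivity
    linarith
  have key : ∀ k : ℕ, ‖(fun x => x - (1 / L) • gradient f x)^[k] x₀ - xs‖ ≤ δ ∧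
      f ((fun x => x - (1 / L) • gradient f x)^[k] x₀) - f xs
        ≤ (1 - μ / L) ^ k * (L / 2 * δ₀ ^ 2) := by
    intro k
    induction k with
    | zero =>
      rw [mem_closedBall, dist_eq_norm] at hx₀
      refine ⟨hx₀.trans hδ₀δ, ?_⟩
      simp only [Function.iterate_zero, id, pow_zero, one_mul]
      refine (hup x₀).trans ?_
      gcongr
    | succ k ih =>
      rw [Function.iterate_succ_apply']
      set y := (fun x => x - (1 / L) • gradient f x)^[k] x₀
      obtain ⟨h1, h2⟩ := ih
      have hqk : (1 - μ / L) ^ k ≤ 1 := pow_le_one₀ hq0.le hq1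
      have h3 : f y - f xs ≤ L / 2 * δ₀ ^ 2 :=
        h2.trans (mul_le_of_le_one_left (by positivity) hqk)
      have h4 := hqg y h1
      constructor
      · have h5 : ‖y - xs‖ ≤ δ / 2 := by
          refine (sq_le_sq₀ (norm_nonneg _) (by positivity)).1 ?_
          refine le_of_mul_le_mul_left ?_ hμ0
          linarith
        have h6 : ‖(1 / L) • gradient f y‖ ≤ ‖y - xs‖ := by
          rw [norm_smul, Real.norm_of_nonneg (by positivity), one_div, inv_mul_le_iff₀ hL]
          exact hgl y
        calc ‖y - (1 / L) • gradient f y - xs‖ = ‖(y - xs) - (1 / L) • gradient f y‖ := by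
              congr 1; abel
          _ ≤ ‖y - xs‖ + ‖(1 / L) • gradient f y‖ := norm_sub_le _ _
          _ ≤ δ := by linarith
      · have h7 := hstep y
        have h8 := hup y
        have h9 := hes y h1
        have h10 : μ / L * (f y - f xs) ≤ 1 / (2 * L) * ‖gradient f y‖ ^ 2 := by
          have a1 : μ / L * (f y - f xs) ≤ μ / L * (L / 2 * ‖y - xs‖ ^ 2) :=
            mul_le_mul_of_nonneg_left h8 (by positivity)
          have a2 := mul_le_mul_of_nonneg_left h9 (show 0 ≤ 1 / (2 * L) by positivity)
          have a3 : μ / L * (L / 2 * ‖y - xs‖ ^ 2) = μ / 2 * ‖y - xs‖ ^ 2 := by field_simp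
          have a4 : 1 / (2 * L) * (2 * L * μ * ‖y - xs‖ ^ 2) = μ * ‖y - xs‖ ^ 2 := by field_simp
          have a5 : 0 ≤ μ * ‖y - xs‖ ^ 2 := by positivity
          linarith
        calc f (y - (1 / L) • gradient f y) - f xs ≤ (1 - μ / L) * (f y - f xs) := by linarith
          _ ≤ (1 - μ / L) * ((1 - μ / L) ^ k * (L / 2 * δ₀ ^ 2)) :=
            mul_le_mul_of_nonneg_left h2 hq0.le
          _ = _ := by ring
  obtain ⟨h1, h2⟩ := key K
  set y := (fun x => x - (1 / L) • gradient f x)^[K] x₀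
  have h3 := hqg y h1
  have hr : ((1 - μ / L) ^ ((K : ℝ) / 2)) ^ 2 = (1 - μ / L) ^ K := by
    rw [← Real.rpow_natCast, ← Real.rpow_mul hq0.le, ← Real.rpow_natCast]
    congr 1
    push_cast
    ring
  have h4 : ‖y - xs‖ ≤ (1 - μ / L) ^ ((K : ℝ) / 2) * δ := by
    have hp : 0 < (1 - μ / L) ^ ((K : ℝ) / 2) := Real.rpow_pos_of_pos hq0 _
    refine (sq_le_sq₀ (norm_nonneg _) (by positivity)).1 ?_
    rw [mul_pow, hr]
    refine le_of_mul_le_mul_left ?_ hμ0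
    have b0 : 0 ≤ (1 - μ / L) ^ K := by positivity
    have b1 : (1 - μ / L) ^ K * (L / 2 * δ₀ ^ 2) ≤ (1 - μ / L) ^ K * (μ * δ ^ 2) :=
      mul_le_mul_of_nonneg_left (by nlinarith [mul_nonneg hL.le (sq_nonneg δ₀)]) b0
    linarith
  have h5 : C * |lam - lam'| ≤ δ₀ / 2 := by
    rw [abs_sub_comm]
    calc C * |lam' - lam| ≤ C * (δ₀ / (2 * C)) := mul_le_mul_of_nonneg_left hclose hC.le
      _ = δ₀ / 2 := by field_simp
  calc ‖y - xhat lam'‖ = ‖(y - xs) + (xs - xhat lam')‖ := by congr 1; abel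
    _ ≤ ‖y - xs‖ + ‖xs - xhat lam'‖ := norm_add_le _ _
    _ ≤ δ₀ := by linarith
end

section
/- (Theorem 1: convergence of the cascade optimization, Algorithm 1.) Let Λ > 0 and let 𝓛 : [0, Λ] × E → ℝ, (λ, x) ↦ 𝓛(x; λ), be differentiable in x. Assume: (A1) there is L > 0 such that for every λ ∈ [0, Λ] the function x ↦ 𝓛(x; λ) is L-smooth; (A2) there exist σ > 0, δ > 0 and a map x̂ : [0, Λ] → E such that for every λ ∈ [0, Λ], x̂(λ) is a global minimizer of 𝓛(·; λ) and ‖x − x̂(λ)‖ ≤ σ·‖∇ₓ𝓛(x; λ)‖ for every x ∈ B(x̂(λ), δ); (A3) there is C > 0 with ‖x̂(λ₁) − x̂(λ₂)‖ ≤ C·|λ₁ − λ₂| for all λ₁, λ₂ ∈ [0, Λ]. Set μ = 1/(2Lσ²), assume L·σ ≥ 1, let δ₀ = min{δ, (μ/√(2(L − μ)L))·δ}, and let ε > 0. Let N ∈ ℕ with N ≥ 2ΛC/δ₀, set λ_i = i·Λ/N for i = 0, …, N, and let K ∈ ℕ satisfy (1 − μ/L)^{K/2}·δ ≤ δ₀/2.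 Define the cascade iterates: u₀ = x̂(0); for i = 1, …, N − 1, u_i is the result of K gradient-descent steps x ↦ x − (1/L)·∇ₓ𝓛(x; λ_i) started at u_{i−1}; finally, u_N is the result of K′ gradient-descent steps x ↦ x − (1/L)·∇ₓ𝓛(x; Λ) started at u_{N−1}, where K′ ∈ ℕ satisfies (1 − μ/L)^{K′/2}·δ ≤ ε. Then the algorithm's output satisfies ‖u_N − x̂(Λ)‖ ≤ ε; in particular it is an ε-approximation of the global minimizer of 𝓛(·; Λ). -/
open Metric

theorem aux_descent {E : Type*} [NormedAddCommGroup E] [InnerProductSpace ℝ E] [CompleteSpace E]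
    (F : E → ℝ) (hF : Differentiable ℝ F) (L : ℝ)
    (hs : ∀ x₁ x₂, ‖gradient F x₁ - gradient F x₂‖ ≤ L * ‖x₁ - x₂‖) (x d : E) :
    F (x + d) ≤ F x + inner ℝ (gradient F x) d + L / 2 * ‖d‖ ^ 2 := by
  have hder : ∀ t : ℝ, HasDerivAt
      (fun t : ℝ => F (x + t • d) - t * inner ℝ (gradient F x) d - L / 2 * ‖d‖ ^ 2 * t ^ 2)
      (inner ℝ (gradient F (x + t • d)) d - inner ℝ (gradient F x) d - L * ‖d‖ ^ 2 * t) t := by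
    intro t
    have h1 : HasFDerivAt F (InnerProductSpace.toDual ℝ E (gradient F (x + t • d))) (x + t • d) :=
      (hF (x + t • d)).hasGradientAt.hasFDerivAt
    have h2 : HasDerivAt (fun t : ℝ => x + t • d) d t := by
      simpa using ((hasDerivAt_id t).smul_const d).const_add x
    have h3 := h1.comp_hasDerivAt t h2
    have h4 := (h3.sub ((hasDerivAt_id t).mul_const (inner ℝ (gradient F x) d))).sub
      ((hasDerivAt_pow 2 t).const_mul (L / 2 * ‖d‖ ^ 2))
    refine HasDerivAt.congr_deriv (h4 : HasDerivAt (fun t : ℝ => F (x + t • d) -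
      t * inner ℝ (gradient F x) d - L / 2 * ‖d‖ ^ 2 * t ^ 2) _ t) ?_
    rw [InnerProductSpace.toDual_apply_apply]
    push_cast
    ring
  have hanti := antitoneOn_of_deriv_nonpos (convex_Icc (0 : ℝ) 1)
    (fun t _ => (hder t).continuousAt.continuousWithinAt)
    (fun t _ => (hder t).differentiableAt.differentiableWithinAt)
    (by
      intro t ht
      rw [interior_Icc] at ht
      rw [(hder t).deriv, ← inner_sub_left]
      have h5 := real_inner_le_norm (gradient F (x + t • d) - gradient F x) d
      have h6 := hs (x + t • d) x
      rw [add_sub_cancel_left, norm_smul, Real.norm_of_nonneg ht.1.le] at h6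
      have h7 := mul_le_mul_of_nonneg_right h6 (norm_nonneg d)
      nlinarith)
  have := hanti (Set.left_mem_Icc.2 zero_le_one) (Set.right_mem_Icc.2 zero_le_one) zero_le_one
  simp only [zero_smul, one_smul, add_zero, zero_mul, one_mul, one_pow, mul_one] at this
  linarith

theorem aux_gd {E : Type*} [NormedAddCommGroup E] [InnerProductSpace ℝ E] [CompleteSpace E]
    (F : E → ℝ) (hF : Differentiable ℝ F) (L : ℝ) (hL : 0 < L)
    (hs : ∀ x₁ x₂, ‖gradient F x₁ - gradient F x₂‖ ≤ L * ‖x₁ - x₂‖)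
    (σ δ : ℝ) (hσ : 0 < σ) (hδ : 0 < δ) (z : E) (hmin : ∀ x, F z ≤ F x)
    (herr : ∀ x ∈ closedBall z δ, ‖x - z‖ ≤ σ * ‖gradient F x‖)
    (μ : ℝ) (hμ : 2 * L * σ ^ 2 * μ = 1) (hμ0 : 0 < μ) (hμL : 2 * μ ≤ L)
    (δ₀ : ℝ) (h0 : 2 * (L - μ) * L * δ₀ ^ 2 ≤ μ ^ 2 * δ ^ 2) (hδ₀ : 0 < δ₀)
    (x : E) (hx : ‖x - z‖ ≤ δ₀) (k : ℕ) :
    ‖(fun x => x - (1 / L) • gradient F x)^[k] x - z‖ ≤ (1 - μ / L) ^ ((k : ℝ) / 2) * δ := by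
  have hg0 : gradient F z = 0 := by
    have : IsLocalMin F z := Filter.Eventually.of_forall hmin
    rw [gradient, this.fderiv_eq_zero, map_zero]
  have hstep : ∀ y, F (y - (1 / L) • gradient F y) ≤ F y - 1 / (2 * L) * ‖gradient F y‖ ^ 2 := by
    intro y
    have h := aux_descent F hF L hs y (-((1 / L) • gradient F y))
    rw [← sub_eq_add_neg, inner_neg_right, real_inner_smul_right, real_inner_self_eq_norm_sq,
      norm_neg, norm_smul, Real.norm_of_nonneg (by positivity)] at h
    refine h.trans (le_of_eq ?_)
    field_simp
    ring
  have hup : ∀ y, F y - F z ≤ L / 2 * ‖y - z‖ ^ 2 := by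
    intro y
    have h := aux_descent F hF L hs z (y - z)
    rw [hg0, inner_zero_left, add_sub_cancel] at h
    linarith
  have hgr : ∀ y, ‖gradient F y‖ ^ 2 ≤ 2 * L * (F y - F z) := by
    intro y
    have h := (hmin _).trans (hstep y)
    have h2 : 1 / (2 * L) * ‖gradient F y‖ ^ 2 ≤ F y - F z := by linarith
    rw [div_mul_eq_mul_div, div_le_iff₀ (by positivity)] at h2
    linarith
  have hsq : ∀ y, ‖y - z‖ ≤ δ → ‖y - z‖ ^ 2 ≤ σ ^ 2 * ‖gradient F y‖ ^ 2 := by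
    intro y hy
    have h := herr y (by rwa [mem_closedBall, dist_eq_norm])
    rw [← mul_pow]
    exact pow_le_pow_left₀ (norm_nonneg _) h 2
  have hqg : ∀ y, ‖y - z‖ ≤ δ → μ * ‖y - z‖ ^ 2 ≤ F y - F z := by
    intro y hy
    have h1 := (hsq y hy).trans (mul_le_mul_of_nonneg_left (hgr y) (sq_nonneg σ))
    have h2 := mul_le_mul_of_nonneg_left h1 hμ0.le
    calc _ ≤ _ := h2
      _ = (2 * L * σ ^ 2 * μ) * (F y - F z) := by ring
      _ = _ := by rw [hμ, one_mul]
  have hq0 : 0 < 1 - μ / L := by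
    have : μ / L < 1 := by rw [div_lt_one hL]; linarith
    linarith
  have hq1 : 1 - μ / L ≤ 1 := by
    have : 0 < μ / L := by positivity
    linarith
  have hcontr : ∀ y, ‖y - z‖ ≤ δ →
      F (y - (1 / L) • gradient F y) - F z ≤ (1 - μ / L) * (F y - F z) := by
    intro y hy
    have h1 := hstep y
    have h2 := (hup y).trans (mul_le_mul_of_nonneg_left (hsq y hy) (by positivity))
    have h3 := mul_le_mul_of_nonneg_left h2 hμ0.le
    have h4 : μ * (L / 2 * (σ ^ 2 * ‖gradient F y‖ ^ 2)) = 1 / 4 * ‖gradient F y‖ ^ 2 := by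
      linear_combination (1 / 4 * ‖gradient F y‖ ^ 2) * hμ
    rw [h4] at h3
    have h5 : μ / L * (F y - F z) ≤ 1 / (2 * L) * ‖gradient F y‖ ^ 2 := by
      rw [div_mul_eq_mul_div, div_mul_eq_mul_div, div_le_div_iff₀ hL (by positivity)]
      nlinarith [sq_nonneg ‖gradient F y‖, mul_nonneg hL.le (sq_nonneg ‖gradient F y‖)]
    linarith
  have hdouble : ∀ y, ‖(y - (1 / L) • gradient F y) - z‖ ≤ 2 * ‖y - z‖ := by
    intro y
    have h1 := hs y z
    rw [hg0, sub_zero] at h1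
    have h2 : ‖(1 / L) • gradient F y‖ ≤ ‖y - z‖ := by
      rw [norm_smul, Real.norm_of_nonneg (by positivity), div_mul_eq_mul_div, one_mul,
        div_le_iff₀ hL]
      linarith
    have h3 := norm_sub_le (y - z) ((1 / L) • gradient F y)
    rw [sub_right_comm] at h3
    linarith
  have hδ₀2 : 4 * (L / 2 * δ₀ ^ 2) ≤ μ * δ ^ 2 := by
    have h1 : (2 * L * δ₀ ^ 2) * μ ≤ μ * δ ^ 2 * μ := by
      have : 2 * L * δ₀ ^ 2 * μ ≤ 2 * L * δ₀ ^ 2 * (L - μ) :=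
        mul_le_mul_of_nonneg_left (by linarith) (by positivity)
      linarith
    have := le_of_mul_le_mul_right h1 hμ0
    linarith
  have hfin : ∀ y (c : ℝ), 0 ≤ c → ‖y - z‖ ≤ δ → F y - F z ≤ c * (L / 2 * δ₀ ^ 2) →
      4 * ‖y - z‖ ^ 2 ≤ c * δ ^ 2 := by
    intro y c hc hy h
    have h1 := hqg y hy
    have h2 := mul_le_mul_of_nonneg_left hδ₀2 hc
    refine le_of_mul_le_mul_left (a := μ) ?_ hμ0
    linarith
  have key : ∀ k : ℕ, ‖(fun x => x - (1 / L) • gradient F x)^[k] x - z‖ ≤ δ ∧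
      F ((fun x => x - (1 / L) • gradient F x)^[k] x) - F z
        ≤ (1 - μ / L) ^ k * (L / 2 * δ₀ ^ 2) := by
    intro k
    induction k with
    | zero =>
      constructor
      · have h1 : δ₀ ^ 2 ≤ δ ^ 2 := by
          refine le_of_mul_le_mul_left (a := 2 * L) ?_ (by positivity)
          nlinarith [sq_nonneg δ]
        exact hx.trans (abs_le_of_sq_le_sq' h1 hδ.le).2
      · simp only [Function.iterate_zero, id, pow_zero, one_mul]
        refine (hup x).trans ?_
        gcongr
    | succ k ih =>
      rw [Function.iterate_succ_apply']
      set y := (fun x => x - (1 / L) • gradient F x)^[k] x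
      obtain ⟨ih1, ih2⟩ := ih
      constructor
      · have h1 := hfin y _ (by positivity) ih1 ih2
        have h2 : (1 - μ / L) ^ k ≤ 1 := pow_le_one₀ hq0.le hq1
        have h3 : (2 * ‖y - z‖) ^ 2 ≤ δ ^ 2 := by nlinarith [sq_nonneg δ]
        exact (hdouble y).trans (abs_le_of_sq_le_sq' h3 hδ.le).2
      · refine (hcontr y ih1).trans ?_
        rw [pow_succ', mul_assoc]
        exact mul_le_mul_of_nonneg_left ih2 hq0.le
  obtain ⟨h1, h2⟩ := key k
  have h3 := hfin _ _ (by positivity) h1 h2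
  have h4 : ((1 - μ / L) ^ ((k : ℝ) / 2)) ^ 2 = (1 - μ / L) ^ k := by
    rw [← Real.rpow_natCast, ← Real.rpow_mul hq0.le, ← Real.rpow_natCast]
    congr 1
    push_cast
    ring
  refine (abs_le_of_sq_le_sq' ?_ (by positivity)).2
  rw [mul_pow, h4]
  nlinarith [sq_nonneg ‖(fun x => x - (1 / L) • gradient F x)^[k] x - z‖]

/-- Theorem 1: convergence of the cascade optimization (Algorithm 1). Under
`L`-smoothness (A1), the local error bound around the minimizers (A2), and
`C`-Lipschitzness of `λ ↦ x̂(λ)` (A3), the cascade iterates `u_0 = x̂(0)`,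
`u_i = K` gradient steps on `𝓛(·; λ_i)` from `u_{i-1}` (with `λ_i = iΛ/N`),
and `u_N = K′` gradient steps on `𝓛(·; Λ)` from `u_{N-1}`, output an
`ε`-approximation of the global minimizer `x̂(Λ)`. -/
theorem cascade_optimization_convergence
    (n : ℕ) (Λ : ℝ) (hΛ : 0 < Λ)
    (𝓛 : ℝ → EuclideanSpace ℝ (Fin n) → ℝ)
    (hdiff : ∀ lam ∈ Set.Icc (0 : ℝ) Λ, Differentiable ℝ (𝓛 lam))
    (L : ℝ) (hL : 0 < L)
    (hsmooth : ∀ lam ∈ Set.Icc (0 : ℝ) Λ, ∀ x₁ x₂,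
      ‖gradient (𝓛 lam) x₁ - gradient (𝓛 lam) x₂‖ ≤ L * ‖x₁ - x₂‖)
    (σ δ : ℝ) (hσ : 0 < σ) (hδ : 0 < δ)
    (xhat : ℝ → EuclideanSpace ℝ (Fin n))
    (hmin : ∀ lam ∈ Set.Icc (0 : ℝ) Λ, ∀ x, 𝓛 lam (xhat lam) ≤ 𝓛 lam x)
    (herr : ∀ lam ∈ Set.Icc (0 : ℝ) Λ, ∀ x ∈ closedBall (xhat lam) δ,
      ‖x - xhat lam‖ ≤ σ * ‖gradient (𝓛 lam) x‖)
    (C : ℝ) (hC : 0 < C)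
    (hlip : ∀ lam₁ ∈ Set.Icc (0 : ℝ) Λ, ∀ lam₂ ∈ Set.Icc (0 : ℝ) Λ,
      ‖xhat lam₁ - xhat lam₂‖ ≤ C * |lam₁ - lam₂|)
    (μ : ℝ) (hμ : μ = 1 / (2 * L * σ ^ 2))
    (hLσ : 1 ≤ L * σ)
    (δ₀ : ℝ) (hδ₀ : δ₀ = min δ (μ / Real.sqrt (2 * (L - μ) * L) * δ))
    (ε : ℝ) (hε : 0 < ε)
    (N : ℕ) (hN : 2 * Λ * C / δ₀ ≤ (N : ℝ))
    (K : ℕ) (hK : (1 - μ / L) ^ ((K : ℝ) / 2) * δ ≤ δ₀ / 2)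
    (K' : ℕ) (hK' : (1 - μ / L) ^ ((K' : ℝ) / 2) * δ ≤ ε)
    (u : ℕ → EuclideanSpace ℝ (Fin n))
    (hu0 : u 0 = xhat 0)
    (hu : ∀ i : ℕ, 1 ≤ i → i ≤ N - 1 →
      u i = (fun x => x - (1 / L) • gradient (𝓛 ((i : ℝ) * Λ / (N : ℝ))) x)^[K]
              (u (i - 1)))
    (huN : u N = (fun x => x - (1 / L) • gradient (𝓛 Λ) x)^[K'] (u (N - 1))) :
    ‖u N - xhat Λ‖ ≤ ε := by
  have hμ' : 2 * L * σ ^ 2 * μ = 1 := by rw [hμ]; field_simp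
  have hμ0 : 0 < μ := by rw [hμ]; positivity
  have hμL : 2 * μ ≤ L := by
    have h1 : 1 ≤ (L * σ) ^ 2 := one_le_pow₀ hLσ
    have h2 : L = 2 * μ * (L * σ) ^ 2 := by linear_combination (-L) * hμ'
    nlinarith
  have hS : 0 < 2 * (L - μ) * L := by
    have : 0 < L - μ := by linarith
    positivity
  have hsS : 0 < Real.sqrt (2 * (L - μ) * L) := Real.sqrt_pos.2 hS
  have hδ₀0 : 0 < δ₀ := by
    rw [hδ₀]
    exact lt_min hδ (by positivity)
  have h0 : 2 * (L - μ) * L * δ₀ ^ 2 ≤ μ ^ 2 * δ ^ 2 := by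
    have h1 : δ₀ ≤ μ / Real.sqrt (2 * (L - μ) * L) * δ := hδ₀ ▸ min_le_right _ _
    rw [div_mul_eq_mul_div, le_div_iff₀ hsS] at h1
    have h2 := pow_le_pow_left₀ (by positivity) h1 2
    rw [mul_pow, mul_pow, Real.sq_sqrt hS.le] at h2
    linarith
  have hNpos : (0 : ℝ) < N := lt_of_lt_of_le (by positivity) hN
  have hN0 : 0 < N := by exact_mod_cast hNpos
  have hstepN : C * (Λ / N) ≤ δ₀ / 2 := by
    rw [div_le_iff₀ hδ₀0] at hN
    rw [← mul_div_assoc, div_le_iff₀ hNpos]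
    linarith
  have hmem : ∀ i : ℕ, i ≤ N → (i : ℝ) * Λ / N ∈ Set.Icc (0 : ℝ) Λ := by
    intro i hi
    have : (i : ℝ) ≤ N := by exact_mod_cast hi
    refine ⟨by positivity, ?_⟩
    rw [div_le_iff₀ hNpos]
    nlinarith
  have hshift : ∀ i : ℕ, i + 1 ≤ N → ‖u i - xhat ((i : ℝ) * Λ / N)‖ ≤ δ₀ / 2 →
      ‖u i - xhat (((i + 1 : ℕ) : ℝ) * Λ / N)‖ ≤ δ₀ := by
    intro i hi h
    have h1 := hlip _ (hmem i (by omega)) _ (hmem (i + 1) hi)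
    have h2 : (i : ℝ) * Λ / N - ((i + 1 : ℕ) : ℝ) * Λ / N = -(Λ / N) := by
      push_cast
      ring
    rw [h2, abs_neg, abs_of_pos (by positivity)] at h1
    have h3 := norm_sub_le_norm_sub_add_norm_sub (u i) (xhat ((i : ℝ) * Λ / N))
      (xhat (((i + 1 : ℕ) : ℝ) * Λ / N))
    linarith
  have hgd := fun lam hl => aux_gd (𝓛 lam) (hdiff lam hl) L hL (hsmooth lam hl) σ δ hσ hδ
    (xhat lam) (hmin lam hl) (herr lam hl) μ hμ' hμ0 hμL δ₀ h0 hδ₀0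
  have hind : ∀ i : ℕ, i ≤ N - 1 → ‖u i - xhat ((i : ℝ) * Λ / N)‖ ≤ δ₀ / 2 := by
    intro i
    induction i with
    | zero =>
      intro _
      simp [hu0]
      positivity
    | succ i ih =>
      intro hi
      have h1 := hshift i (by omega) (ih (by omega))
      rw [hu (i + 1) (by omega) hi]
      exact (hgd _ (hmem (i + 1) (by omega)) _ h1 K).trans hK
  have h1 := hshift (N - 1) (by omega) (hind (N - 1) le_rfl)
  rw [Nat.sub_add_cancel hN0, mul_div_cancel_left₀ _ hNpos.ne'] at h1
  rw [huN]
  exact (hgd Λ ⟨hΛ.le, le_rfl⟩ _ h1 K').trans hK'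
end
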